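/- Let k ≥ 2 and let f₁, …, f_k be measurable probability density functions on ℝ. For every p in the open simplex, the weight Fisher matrix M(p) has finite entries, is symmetric positive semidefinite, and the function p ↦ √(det M(p)) is Lebesgue integrable over the simplex, i.e. ∫_{simplex} √(det M(p)) dp < ∞. (In the paper's terminology: when the weights p₁, …, p_k are the only unknown parameters of the mixture Σ_ℓ p_ℓ f_ℓ, the Jeffreys prior √(det M(p)) is proper.) -/

import Mathlib

open MeasureTheory

noncomputable section

/-- The mixture density `∑ ℓ pℓ fℓ(x)`. -/
def mixDens {k : ℕ} (f : Fin k → ℝ → ℝ) (p : Fin k → ℝ) (x : ℝ) : ℝ :=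
  ∑ ℓ, p ℓ * f ℓ x

/-- The `(k-1) × (k-1)` Fisher information matrix for the weights of a mixture of
`k = m + 2` densities `f₀, …, f_{m+1}`, with entries
`M_{jh}(p) = ∫ (f_j - f_{k-1})(f_h - f_{k-1}) / (∑ℓ pℓ fℓ)` (division by zero being zero). -/
def weightFisher {m : ℕ} (f : Fin (m + 2) → ℝ → ℝ) (p : Fin (m + 2) → ℝ) :
    Matrix (Fin (m + 1)) (Fin (m + 1)) ℝ := fun j h =>
  ∫ x : ℝ,
    (f j.castSucc x - f (Fin.last (m + 1)) x) * (f h.castSucc x - f (Fin.last (m + 1)) x) /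
      mixDens f p x

/-- Extension of the free weights `(p₀, …, p_{k-2})` to the full weight vector,
the last weight being `1 - ∑_{j<k-1} p_j`. -/
def fullWeight {m : ℕ} (q : Fin (m + 1) → ℝ) : Fin (m + 2) → ℝ :=
  Fin.snoc q (1 - ∑ j, q j)

/-- The open simplex in the free coordinates: `q ∈ (0,1)^{k-1}` with `∑ q_j < 1`. -/
def openSimplexFree (m : ℕ) : Set (Fin (m + 1) → ℝ) :=
  {q | (∀ j, 0 < q j ∧ q j < 1) ∧ ∑ j, q j < 1}

open Matrix in
lemma aux_det_le_one {n : Type*} [Fintype n] [DecidableEq n] (N : Matrix n n ℝ)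
    (hN : N.PosSemidef) (h1 : (1 - N).PosSemidef) : N.det ≤ 1 := by
  have key := hN.isHermitian.det_eq_prod_eigenvalues
  rw [key]
  refine Finset.prod_le_one (fun i _ => by simpa using hN.eigenvalues_nonneg i) (fun i _ => ?_)
  have h2 := hN.isHermitian.eigenvalues_eq i
  have h3 := h1.dotProduct_mulVec_nonneg (hN.isHermitian.eigenvectorBasis i).ofLp
  rw [Matrix.sub_mulVec, dotProduct_sub, Matrix.one_mulVec] at h3
  have h4 : ‖hN.isHermitian.eigenvectorBasis i‖ = 1 := hN.isHermitian.eigenvectorBasis.norm_eq_one i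
  have h5 : star (hN.isHermitian.eigenvectorBasis i).ofLp ⬝ᵥ
      (hN.isHermitian.eigenvectorBasis i).ofLp = 1 := by
    have := EuclideanSpace.real_norm_sq_eq (hN.isHermitian.eigenvectorBasis i)
    rw [h4] at this
    simp only [dotProduct, star_trivial]
    simp only [← pow_two]
    linarith
  simp only [RCLike.re_to_real, RCLike.ofReal_real_eq_id, id] at h2 ⊢
  linarith

open Matrix in
lemma aux_det_mono {n : Type*} [Fintype n] [DecidableEq n] (A B : Matrix n n ℝ)
    (hA : A.PosSemidef) (h1 : (B - A).PosSemidef) (hB : 0 < B.det) : A.det ≤ B.det := by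
  have hBp : B.PosSemidef := by simpa using hA.add h1
  obtain ⟨S, hS⟩ : ∃ S : Matrix n n ℝ, B = Sᴴ * S := by
    open scoped MatrixOrder in
    exact CStarAlgebra.nonneg_iff_eq_star_mul_self.mp hBp.nonneg
  have hdet : B.det = S.det * S.det := by
    rw [hS, det_mul, det_conjTranspose, star_trivial]
  have hS0 : S.det ≠ 0 := by
    rintro h; rw [hdet, h] at hB; simp at hB
  have hu : IsUnit S.det := isUnit_iff_ne_zero.2 hS0
  have e1 : S⁻¹ᴴ * B * S⁻¹ = 1 := by
    rw [hS]
    rw [← Matrix.mul_assoc, ← conjTranspose_mul, Matrix.mul_assoc, Matrix.mul_nonsing_inv _ hu]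
    simp
  have hN := hA.conjTranspose_mul_mul_same S⁻¹
  have hN1 := h1.conjTranspose_mul_mul_same S⁻¹
  rw [Matrix.mul_sub, Matrix.sub_mul, e1] at hN1
  have := aux_det_le_one _ hN hN1
  rw [det_mul, det_mul, det_conjTranspose, star_trivial, det_nonsing_inv, Ring.inverse_eq_inv'] at this
  rw [hdet]
  have h6 : A.det = (S.det⁻¹ * A.det * S.det⁻¹) * (S.det * S.det) := by field_simp
  rw [h6]
  have : 0 ≤ S.det * S.det := mul_self_nonneg _
  nlinarith

/-- multinomial Fisher matrix -/
noncomputable def auxB {m : ℕ} (p : Fin (m + 2) → ℝ) : Matrix (Fin (m + 1)) (Fin (m + 1)) ℝ :=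
  Matrix.diagonal (fun j : Fin (m+1) => (p j.castSucc)⁻¹) +
    (Matrix.replicateCol Unit (fun _ : Fin (m+1) => (p (Fin.last (m+1)))⁻¹) *
      Matrix.replicateRow Unit (fun _ : Fin (m+1) => (1:ℝ)) : Matrix (Fin (m+1)) (Fin (m+1)) ℝ)

open Matrix in
lemma auxB_det {m : ℕ} (p : Fin (m + 2) → ℝ) (hp : ∀ l, 0 < p l) (hs : ∑ l, p l = 1) :
    (auxB p).det = ∏ l, (p l)⁻¹ := by
  have hd : (Matrix.diagonal (fun j : Fin (m+1) => (p j.castSucc)⁻¹)).det ≠ 0 := by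
    rw [det_diagonal]
    exact Finset.prod_ne_zero_iff.2 fun i _ => (inv_pos.2 (hp _)).ne'
  rw [auxB, det_add_replicateCol_mul_replicateRow (isUnit_iff_ne_zero.2 hd), det_diagonal,
    Fin.prod_univ_castSucc (f := fun l => (p l)⁻¹)]
  congr 1
  have hi : (Matrix.diagonal (fun j : Fin (m+1) => (p j.castSucc)⁻¹))⁻¹ =
      Matrix.diagonal (fun j : Fin (m+1) => p j.castSucc) := by
    apply Matrix.inv_eq_left_inv
    rw [diagonal_mul_diagonal]
    convert Matrix.diagonal_one using 2
    ext j
    exact mul_inv_cancel₀ (hp _).ne'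
  rw [hi, det_unique]
  rw [Fin.sum_univ_castSucc] at hs
  simp only [Matrix.add_apply, Matrix.one_apply_eq, Matrix.mul_apply, Matrix.replicateRow_apply,
    Matrix.replicateCol_apply, Matrix.diagonal_apply]
  simp
  rw [← Finset.sum_mul]
  have := (hp (Fin.last (m+1))).ne'
  field_simp
  linarith

open Matrix in
lemma auxB_quad {m : ℕ} (p : Fin (m + 2) → ℝ) (v : Fin (m+1) → ℝ) :
    star v ⬝ᵥ (auxB p) *ᵥ v = ∑ j, v j ^ 2 * (p j.castSucc)⁻¹ +
      (∑ j, v j)^2 * (p (Fin.last (m+1)))⁻¹ := by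
  rw [auxB, Matrix.add_mulVec, dotProduct_add]
  congr 1
  · simp only [dotProduct, mulVec_diagonal, star_trivial]
    exact Finset.sum_congr rfl fun i _ => by ring
  · simp only [dotProduct, mulVec, Matrix.mul_apply, replicateCol_apply, replicateRow_apply]
    simp
    rw [← Finset.mul_sum, ← Finset.sum_mul]
    ring

lemma auxB_herm {m : ℕ} (p : Fin (m + 2) → ℝ) : (auxB p).IsHermitian := by
  ext i j
  simp [auxB, Matrix.diagonal_apply, Matrix.mul_apply, eq_comm]
  by_cases h : i = j
  · simp [h]
  · simp [h]



lemma aux_le_mix {m : ℕ} (f : Fin (m + 2) → ℝ → ℝ) (hnonneg : ∀ ℓ x, 0 ≤ f ℓ x)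
    (p : Fin (m + 2) → ℝ) (hp : ∀ l, 0 < p l) (l : Fin (m+2)) (x : ℝ) :
    p l * f l x ≤ mixDens f p x :=
  Finset.single_le_sum (f := fun l => p l * f l x)
    (fun i _ => mul_nonneg (hp i).le (hnonneg i x)) (Finset.mem_univ l)

lemma aux_mix_nonneg {m : ℕ} (f : Fin (m + 2) → ℝ → ℝ) (hnonneg : ∀ ℓ x, 0 ≤ f ℓ x)
    (p : Fin (m + 2) → ℝ) (hp : ∀ l, 0 < p l) (x : ℝ) :
    0 ≤ mixDens f p x :=
  Finset.sum_nonneg (fun i _ => mul_nonneg (hp i).le (hnonneg i x))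

lemma aux_mix_meas {m : ℕ} (f : Fin (m + 2) → ℝ → ℝ) (hmeas : ∀ ℓ, Measurable (f ℓ))
    (p : Fin (m + 2) → ℝ) : Measurable (mixDens f p) := by
  unfold mixDens
  exact Finset.measurable_sum _ fun i _ => (hmeas i).const_mul _

lemma aux_integrable {m : ℕ} (f : Fin (m + 2) → ℝ → ℝ)
    (hmeas : ∀ ℓ, Measurable (f ℓ)) (hnonneg : ∀ ℓ x, 0 ≤ f ℓ x)
    (hpdf : ∀ ℓ, ∫ x : ℝ, f ℓ x = 1)
    (p : Fin (m + 2) → ℝ) (hp : ∀ l, 0 < p l) (j h : Fin (m + 1)) :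
    Integrable (fun x : ℝ =>
          (f j.castSucc x - f (Fin.last (m + 1)) x) *
            (f h.castSucc x - f (Fin.last (m + 1)) x) / mixDens f p x) := by
  have hi : ∀ l, Integrable (f l) := fun l =>
    Integrable.of_integral_ne_zero (by rw [hpdf l]; exact one_ne_zero)
  refine Integrable.mono' (((hi h.castSucc).add (hi (Fin.last (m+1)))).const_mul
    ((p j.castSucc)⁻¹ + (p (Fin.last (m+1)))⁻¹)) ?_ ?_
  · exact ((((hmeas _).sub (hmeas _)).mul ((hmeas _).sub (hmeas _))).div
      (aux_mix_meas f hmeas p)).aestronglyMeasurable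
  · refine Filter.Eventually.of_forall fun x => ?_
    have h1 : ∀ l, f l x ≤ (p l)⁻¹ * mixDens f p x := fun l => by
      rw [inv_mul_eq_div, le_div_iff₀ (hp l), mul_comm]
      exact aux_le_mix f hnonneg p hp l x
    have hg := aux_mix_nonneg f hnonneg p hp x
    have hc : 0 ≤ (p j.castSucc)⁻¹ + (p (Fin.last (m+1)))⁻¹ :=
      add_nonneg (inv_pos.2 (hp _)).le (inv_pos.2 (hp _)).le
    have hab : ∀ a b : ℝ, 0 ≤ a → 0 ≤ b → |a - b| ≤ a + b := fun a b ha hb =>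
      abs_le.2 ⟨by linarith, by linarith⟩
    rw [Real.norm_eq_abs, abs_div, abs_mul, abs_of_nonneg hg]
    have a1 := hab _ _ (hnonneg j.castSucc x) (hnonneg (Fin.last (m+1)) x)
    have a2 := hab _ _ (hnonneg h.castSucc x) (hnonneg (Fin.last (m+1)) x)
    have b1 := h1 j.castSucc
    have b2 := h1 (Fin.last (m+1))
    simp only [Pi.add_apply]
    apply div_le_of_le_mul₀ hg (mul_nonneg hc (add_nonneg (hnonneg _ x) (hnonneg _ x)))
    calc _ ≤ (((p j.castSucc)⁻¹ + (p (Fin.last (m+1)))⁻¹) * mixDens f p x) *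
          (f h.castSucc x + f (Fin.last (m+1)) x) :=
          mul_le_mul (by linarith) a2 (abs_nonneg _) (mul_nonneg hc hg)
      _ = _ := by ring

open Matrix in
lemma aux_quad {m : ℕ} (f : Fin (m + 2) → ℝ → ℝ)
    (hmeas : ∀ ℓ, Measurable (f ℓ)) (hnonneg : ∀ ℓ x, 0 ≤ f ℓ x)
    (hpdf : ∀ ℓ, ∫ x : ℝ, f ℓ x = 1)
    (p : Fin (m + 2) → ℝ) (hp : ∀ l, 0 < p l) (v : Fin (m+1) → ℝ) :
    Integrable (fun x => (∑ j, v j * (f j.castSucc x - f (Fin.last (m + 1)) x)) ^ 2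
        / mixDens f p x) ∧
    star v ⬝ᵥ (weightFisher f p) *ᵥ v =
      ∫ x, (∑ j, v j * (f j.castSucc x - f (Fin.last (m + 1)) x)) ^ 2 / mixDens f p x := by
  have hI := aux_integrable f hmeas hnonneg hpdf p hp
  have e : (fun x => (∑ j, v j * (f j.castSucc x - f (Fin.last (m + 1)) x)) ^ 2
      / mixDens f p x) = fun x => ∑ j, ∑ h, v j * v h * (
          (f j.castSucc x - f (Fin.last (m + 1)) x) *
            (f h.castSucc x - f (Fin.last (m + 1)) x) / mixDens f p x) := by
    ext x
    rw [pow_two, Finset.sum_mul_sum, Finset.sum_div]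
    refine Finset.sum_congr rfl fun j _ => ?_
    rw [Finset.sum_div]
    exact Finset.sum_congr rfl fun h _ => by ring
  rw [e]
  have i1 : ∀ j h, Integrable (fun x => v j * v h * (
          (f j.castSucc x - f (Fin.last (m + 1)) x) *
            (f h.castSucc x - f (Fin.last (m + 1)) x) / mixDens f p x)) :=
    fun j h => (hI j h).const_mul _
  refine ⟨integrable_finsetSum _ fun j _ => integrable_finsetSum _ fun h _ => i1 j h, ?_⟩
  rw [integral_finsetSum _ fun j _ => integrable_finsetSum _ fun h _ => i1 j h]
  simp only [dotProduct, mulVec, star_trivial]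
  refine Finset.sum_congr rfl fun j _ => ?_
  rw [integral_finsetSum _ fun h _ => i1 j h, Finset.mul_sum]
  refine Finset.sum_congr rfl fun h _ => ?_
  rw [integral_const_mul]
  simp only [weightFisher]
  ring

lemma aux_herm {m : ℕ} (f : Fin (m + 2) → ℝ → ℝ) (p : Fin (m + 2) → ℝ) :
    (weightFisher f p).IsHermitian := by
  ext i j
  simp only [Matrix.conjTranspose_apply, star_trivial, weightFisher]
  congr 1
  ext x
  ring

lemma aux_psd {m : ℕ} (f : Fin (m + 2) → ℝ → ℝ)
    (hmeas : ∀ ℓ, Measurable (f ℓ)) (hnonneg : ∀ ℓ x, 0 ≤ f ℓ x)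
    (hpdf : ∀ ℓ, ∫ x : ℝ, f ℓ x = 1)
    (p : Fin (m + 2) → ℝ) (hp : ∀ l, 0 < p l) : (weightFisher f p).PosSemidef := by
  refine Matrix.PosSemidef.of_dotProduct_mulVec_nonneg (aux_herm f p) fun v => ?_
  rw [(aux_quad f hmeas hnonneg hpdf p hp v).2]
  exact integral_nonneg fun x => div_nonneg (sq_nonneg _) (aux_mix_nonneg f hnonneg p hp x)

lemma aux_loewner {m : ℕ} (f : Fin (m + 2) → ℝ → ℝ)
    (hmeas : ∀ ℓ, Measurable (f ℓ)) (hnonneg : ∀ ℓ x, 0 ≤ f ℓ x)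
    (hpdf : ∀ ℓ, ∫ x : ℝ, f ℓ x = 1)
    (p : Fin (m + 2) → ℝ) (hp : ∀ l, 0 < p l) : (auxB p - weightFisher f p).PosSemidef := by
  refine Matrix.PosSemidef.of_dotProduct_mulVec_nonneg
    ((auxB_herm p).sub (aux_herm f p)) fun v => ?_
  rw [Matrix.sub_mulVec, dotProduct_sub, sub_nonneg, auxB_quad]
  obtain ⟨h1, h2⟩ := aux_quad f hmeas hnonneg hpdf p hp v
  rw [h2]
  have hi : ∀ l, Integrable (f l) := fun l =>
    Integrable.of_integral_ne_zero (by rw [hpdf l]; exact one_ne_zero)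
  set w : Fin (m+2) → ℝ := Fin.snoc v (-∑ j, v j) with hw
  have wc : ∀ j : Fin (m+1), w j.castSucc = v j := fun j => by simp [hw]
  have wl : w (Fin.last (m+1)) = -∑ j, v j := by simp [hw]
  have e : ∑ j, v j ^ 2 * (p j.castSucc)⁻¹ + (∑ j, v j)^2 * (p (Fin.last (m+1)))⁻¹ =
      ∫ x, ∑ l, w l ^ 2 * (p l)⁻¹ * f l x := by
    rw [integral_finsetSum _ fun l _ => (hi l).const_mul _]
    simp only [integral_const_mul, hpdf, mul_one]
    rw [Fin.sum_univ_castSucc (f := fun l => w l ^ 2 * (p l)⁻¹)]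
    simp only [wc, wl, neg_sq]
  rw [e]
  refine integral_mono h1 (integrable_finsetSum _ fun l _ => (hi l).const_mul _) fun x => ?_
  have hn : ∀ l, 0 ≤ w l ^ 2 * (p l)⁻¹ * f l x := fun l =>
    mul_nonneg (mul_nonneg (sq_nonneg _) (inv_pos.2 (hp _)).le) (hnonneg _ _)
  apply div_le_of_le_mul₀ (aux_mix_nonneg f hnonneg p hp x) (Finset.sum_nonneg fun l _ => hn l)
  have e2 : ∑ j, v j * (f j.castSucc x - f (Fin.last (m + 1)) x) = ∑ l, w l * f l x := by
    rw [Fin.sum_univ_castSucc (f := fun l => w l * f l x)]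
    simp only [wc, wl, mul_sub, Finset.sum_sub_distrib, ← Finset.sum_mul]
    ring
  rw [e2]
  refine Finset.sum_sq_le_sum_mul_sum_of_sq_le_mul _ (fun l _ => hn l)
    (fun l _ => mul_nonneg (hp l).le (hnonneg l x)) fun l _ => le_of_eq ?_
  have := (hp l).ne'
  field_simp

lemma aux_det_bound {m : ℕ} (f : Fin (m + 2) → ℝ → ℝ)
    (hmeas : ∀ ℓ, Measurable (f ℓ)) (hnonneg : ∀ ℓ x, 0 ≤ f ℓ x)
    (hpdf : ∀ ℓ, ∫ x : ℝ, f ℓ x = 1)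
    (p : Fin (m + 2) → ℝ) (hp : ∀ l, 0 < p l) (hs : ∑ l, p l = 1) :
    (weightFisher f p).det ≤ ∏ l, (p l)⁻¹ := by
  have hd := auxB_det p hp hs
  rw [← hd]
  refine aux_det_mono _ _ (aux_psd f hmeas hnonneg hpdf p hp)
    (aux_loewner f hmeas hnonneg hpdf p hp) ?_
  rw [hd]
  exact Finset.prod_pos fun l _ => inv_pos.2 (hp l)


lemma aux_meas {m : ℕ} (f : Fin (m + 2) → ℝ → ℝ) (hmeas : ∀ ℓ, Measurable (f ℓ)) :
    Measurable (fun q : Fin (m+1) → ℝ => Real.sqrt (weightFisher f (fullWeight q)).det) := by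
  have hfw : ∀ l, Measurable fun q : Fin (m+1) → ℝ => fullWeight q l := by
    intro l
    refine Fin.lastCases ?_ (fun j => ?_) l
    · simp only [fullWeight, Fin.snoc_last]
      fun_prop
    · simp only [fullWeight, Fin.snoc_castSucc]
      fun_prop
  have hent : ∀ j h, Measurable fun q : Fin (m+1) → ℝ => weightFisher f (fullWeight q) j h := by
    intro j h
    refine (StronglyMeasurable.integral_prod_right (f := fun (q : Fin (m+1) → ℝ) (x : ℝ) =>
      (f j.castSucc x - f (Fin.last (m + 1)) x) * (f h.castSucc x - f (Fin.last (m + 1)) x) /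
      mixDens f (fullWeight q) x) (Measurable.stronglyMeasurable ?_)).measurable
    simp only [Function.uncurry_def, mixDens]
    refine Measurable.div ?_ (Finset.measurable_sum _ fun l _ => ?_)
    · exact (((hmeas _).comp measurable_snd).sub ((hmeas _).comp measurable_snd)).mul
        (((hmeas _).comp measurable_snd).sub ((hmeas _).comp measurable_snd))
    · exact ((hfw l).comp measurable_fst).mul ((hmeas l).comp measurable_snd)
  refine Real.continuous_sqrt.measurable.comp ?_
  simp only [Matrix.det_apply]
  exact Finset.measurable_sum _ fun s _ =>
    (Finset.measurable_prod _ fun i _ => hent _ _).const_smul _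

def auxPhi (t : ℝ) : ℝ := Set.indicator (Set.Ioo (0:ℝ) 1) (fun t => Real.sqrt t⁻¹) t

lemma auxPhi_nonneg (t : ℝ) : 0 ≤ auxPhi t :=
  Set.indicator_nonneg (fun _ _ => Real.sqrt_nonneg _) t

lemma auxPhi_integrable : Integrable auxPhi := by
  have h := (intervalIntegral.intervalIntegrable_rpow' (a := 0) (b := 1) (r := -(1/2))
    (by norm_num))
  rw [intervalIntegrable_iff_integrableOn_Ioo_of_le zero_le_one] at h
  have h2 : IntegrableOn (fun t : ℝ => Real.sqrt t⁻¹) (Set.Ioo 0 1) := by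
    refine h.congr_fun (fun t ht => ?_) measurableSet_Ioo
    simp only
    rw [Real.sqrt_inv, Real.rpow_neg ht.1.le, Real.sqrt_eq_rpow]
  exact h2.integrable_indicator measurableSet_Ioo

def auxL {m : ℕ} (r : Fin (m+1)) : (Fin (m+1) → ℝ) →ₗ[ℝ] (Fin (m+1) → ℝ) where
  toFun q := Function.update q r (-∑ j, q j)
  map_add' a b := by
    ext j
    by_cases h : j = r
    · subst h; simp [Finset.sum_add_distrib]; ring
    · simp [h]
  map_smul' c a := by
    ext j
    by_cases h : j = r
    · subst h; simp [Finset.mul_sum]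
    · simp [h]

lemma auxL_sq {m : ℕ} (r : Fin (m+1)) : auxL r * auxL r = 1 := by
  ext1 i
  ext j
  simp only [LinearMap.comp_apply, Module.End.mul_apply, Module.End.one_apply]
  generalize (LinearMap.single ℝ (fun _ : Fin (m+1) => ℝ) i) 1 = q
  simp only [auxL, LinearMap.coe_mk, AddHom.coe_mk]
  by_cases h : j = r
  · subst h
    simp only [Function.update_self]
    rw [Finset.sum_update_of_mem (Finset.mem_univ _),
      Finset.sum_eq_add_sum_sdiff_singleton_of_mem (Finset.mem_univ j) q]
    ring
  · simp [h]

lemma auxL_mp {m : ℕ} (r : Fin (m+1)) : MeasurePreserving (auxL (m := m) r) := by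
  have hd : LinearMap.det (auxL (m := m) r) * LinearMap.det (auxL (m := m) r) = 1 := by
    rw [← map_mul, auxL_sq, map_one]
  have h0 : LinearMap.det (auxL (m := m) r) ≠ 0 := fun h => by rw [h] at hd; simp at hd
  have h1 : |(LinearMap.det (auxL (m := m) r))⁻¹| = 1 := by
    rw [abs_inv, inv_eq_one]
    rcases mul_self_eq_one_iff.1 hd with h | h <;> rw [h] <;> simp
  refine ⟨(LinearMap.continuous_of_finiteDimensional _).measurable, ?_⟩
  rw [Real.map_linearMap_volume_pi_eq_smul_volume_pi h0, h1]
  simp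

lemma auxT_mp {m : ℕ} (r : Fin (m+1)) : MeasurePreserving
    (fun q : Fin (m+1) → ℝ => Function.update q r (1 - ∑ j, q j)) := by
  have h := (measurePreserving_add_right (volume : Measure (Fin (m+1) → ℝ))
    (Pi.single r 1)).comp (auxL_mp r)
  suffices e : (fun q : Fin (m+1) → ℝ => Function.update q r (1 - ∑ j, q j)) =
      (fun x => x + Pi.single r 1) ∘ (auxL r) by rw [e]; exact h
  funext q j
  simp only [auxL, Function.comp, LinearMap.coe_mk, AddHom.coe_mk, Pi.add_apply]
  by_cases h : j = r
  · subst h; simp; ring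
  · simp [h]

def auxF {m : ℕ} (q : Fin (m+1) → ℝ) : ℝ := ∏ j, auxPhi (q j)

lemma auxF_integrable {m : ℕ} : Integrable (auxF (m := m)) := by
  unfold auxF
  rw [volume_pi]
  exact Integrable.fintype_prod fun _ => auxPhi_integrable

lemma auxF_nonneg {m : ℕ} (q : Fin (m+1) → ℝ) : 0 ≤ auxF q :=
  Finset.prod_nonneg fun _ _ => auxPhi_nonneg _

def auxG {m : ℕ} (q : Fin (m+1) → ℝ) : ℝ :=
  Real.sqrt (m+2) * (auxF q + ∑ r, auxF (Function.update q r (1 - ∑ j, q j)))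

lemma auxG_integrable {m : ℕ} : Integrable (auxG (m := m)) := by
  unfold auxG
  refine (auxF_integrable.add (integrable_finsetSum _ fun r _ => ?_)).const_mul _
  exact (auxT_mp r).integrable_comp_of_integrable auxF_integrable

lemma auxF_eq {m : ℕ} (q : Fin (m+1) → ℝ) (h : ∀ j, 0 < q j ∧ q j < 1) :
    auxF q = ∏ j, Real.sqrt (q j)⁻¹ := by
  refine Finset.prod_congr rfl fun j _ => ?_
  exact Set.indicator_of_mem (show q j ∈ Set.Ioo (0:ℝ) 1 from h j) _

lemma aux_full_pos {m : ℕ} (q : Fin (m+1) → ℝ) (hq : q ∈ openSimplexFree m) (l) :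
    0 < fullWeight q l := by
  refine Fin.lastCases ?_ (fun j => ?_) l
  · simp only [fullWeight, Fin.snoc_last]; linarith [hq.2]
  · simp only [fullWeight, Fin.snoc_castSucc]; exact (hq.1 j).1

lemma aux_full_sum {m : ℕ} (q : Fin (m+1) → ℝ) : ∑ l, fullWeight q l = 1 := by
  rw [Fin.sum_univ_castSucc]
  simp [fullWeight]

lemma aux_bound {m : ℕ} (q : Fin (m+1) → ℝ) (hq : q ∈ openSimplexFree m) :
    Real.sqrt (∏ l, (fullWeight q l)⁻¹) ≤ auxG q := by
  have hpos := aux_full_pos q hq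
  have hsum := aux_full_sum q
  have e : Real.sqrt (∏ l, (fullWeight q l)⁻¹) = ∏ l, Real.sqrt (fullWeight q l)⁻¹ :=
    Real.sqrt_prod _ fun l _ => (inv_pos.2 (hpos l)).le
  have hs0 : 0 < 1 - ∑ j, q j := by linarith [hq.2]
  have hs1 : 1 - ∑ j, q j < 1 := by
    have : 0 < ∑ j, q j := Finset.sum_pos (fun j _ => (hq.1 j).1) Finset.univ_nonempty
    linarith
  have hm : (0:ℝ) < m + 2 := by positivity
  obtain ⟨l, hl⟩ : ∃ l, ((m:ℝ)+2)⁻¹ ≤ fullWeight q l := by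
    by_contra! hcon
    have := Finset.sum_lt_sum_of_nonempty (s := Finset.univ) Finset.univ_nonempty
      (fun l _ => hcon l)
    rw [hsum] at this
    simp at this
    rw [mul_inv_cancel₀ hm.ne'] at this
    exact lt_irrefl _ this
  have hl2 : Real.sqrt (fullWeight q l)⁻¹ ≤ Real.sqrt (m+2) :=
    Real.sqrt_le_sqrt (inv_le_of_inv_le₀ hm hl)
  have hN : ∀ r, 0 ≤ auxF (Function.update q r (1 - ∑ j, q j)) := fun r => auxF_nonneg _
  have hq0 := auxF_nonneg q
  rw [e, Fin.prod_univ_castSucc, auxG]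
  have c1 : ∀ j : Fin (m+1), fullWeight q j.castSucc = q j := fun j => by simp [fullWeight]
  have c2 : fullWeight q (Fin.last (m+1)) = 1 - ∑ j, q j := by simp [fullWeight]
  induction l using Fin.lastCases with
  | last =>
    rw [mul_comm]
    refine mul_le_mul hl2 ?_ (Finset.prod_nonneg fun _ _ => Real.sqrt_nonneg _)
      (Real.sqrt_nonneg _)
    simp only [c1]
    rw [← auxF_eq q hq.1]
    linarith [Finset.sum_nonneg fun r (_ : r ∈ Finset.univ) => hN r]
  | cast r =>
    rw [c1] at hl2
    simp only [c1, c2]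
    have h1 : auxF (Function.update q r (1 - ∑ j, q j)) =
        Real.sqrt (1 - ∑ j, q j)⁻¹ * ∏ j ∈ Finset.univ \ {r}, Real.sqrt (q j)⁻¹ := by
      rw [auxF_eq]
      · rw [Finset.prod_eq_mul_prod_sdiff_singleton_of_mem (Finset.mem_univ r)]
        rw [Function.update_self]
        congr 1
        refine Finset.prod_congr rfl fun j hj => ?_
        rw [Function.update_of_ne]
        simpa using hj
      · intro j
        by_cases h : j = r
        · subst h; simpa using ⟨hq.2, by linarith⟩
        · simpa [h] using hq.1 j
    rw [Finset.prod_eq_mul_prod_sdiff_singleton_of_mem (Finset.mem_univ r), mul_assoc,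
      mul_comm (∏ j ∈ _, _), ← h1]
    refine mul_le_mul hl2 ?_ (hN r) (Real.sqrt_nonneg _)
    linarith [Finset.single_le_sum (fun r (_ : r ∈ Finset.univ) => hN r) (Finset.mem_univ r)]

lemma aux_simplex_meas (m : ℕ) : MeasurableSet (openSimplexFree m) := by
  unfold openSimplexFree
  measurability

/-- for a mixture of `m + 2 ≥ 2` measurable probability densities on `ℝ`,
for every `p` in the open simplex the weight Fisher matrix has finite (integrable)
entries and is symmetric positive semidefinite, and the Jeffreys prior
`p ↦ √(det M(p))` is Lebesgue integrable over the simplex (i.e. it is proper). -/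
theorem jeffreys_prior_weights_proper (m : ℕ) (f : Fin (m + 2) → ℝ → ℝ)
    (hmeas : ∀ ℓ, Measurable (f ℓ)) (hnonneg : ∀ ℓ x, 0 ≤ f ℓ x)
    (hpdf : ∀ ℓ, ∫ x : ℝ, f ℓ x = 1) :
    (∀ p : Fin (m + 2) → ℝ, (∀ ℓ, 0 < p ℓ ∧ p ℓ < 1) → ∑ ℓ, p ℓ = 1 →
      (∀ j h : Fin (m + 1),
        Integrable (fun x : ℝ =>
          (f j.castSucc x - f (Fin.last (m + 1)) x) *
            (f h.castSucc x - f (Fin.last (m + 1)) x) / mixDens f p x)) ∧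
      (weightFisher f p).PosSemidef) ∧
    IntegrableOn (fun q => Real.sqrt (weightFisher f (fullWeight q)).det)
      (openSimplexFree m) volume := by
  refine ⟨fun p hp hs => ⟨aux_integrable f hmeas hnonneg hpdf p fun l => (hp l).1,
    aux_psd f hmeas hnonneg hpdf p fun l => (hp l).1⟩, ?_⟩
  refine Integrable.mono' (auxG_integrable.integrableOn) (aux_meas f hmeas).aestronglyMeasurable ?_
  refine (ae_restrict_iff' (aux_simplex_meas m)).2 (Filter.Eventually.of_forall fun q hq => ?_)
  rw [Real.norm_eq_abs, abs_of_nonneg (Real.sqrt_nonneg _)]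
  exact (Real.sqrt_le_sqrt (aux_det_bound f hmeas hnonneg hpdf _ (aux_full_pos q hq)
    (aux_full_sum q))).trans (aux_bound q hq)
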